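/- arXiv:2306.06100 — 2 statements merged into one kernel-verified Lean document; each statement's English description precedes it below -/
import Mathlib

section
/- Multiplication by f^{δ(i)} induces an isomorphism H^i(M)/H^i(M)[f^{δ(i)-δ(i-1)}] ≅ H^i(η_{δ,f}M) for every i ∈ ℤ. In particular, the functor η_{δ,f} on f-torsion-free cochain complexes preserves quasi-isomorphisms. -/
noncomputable section

variable {R : Type*} [CommRing R] (f : R)

/-- `f`, as a unit of the localization `R[1/f]`. -/
def fUnit : (Localization (Submonoid.powers f))ˣ :=
  (IsLocalization.map_units (Localization (Submonoid.powers f))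
    (⟨f, Submonoid.mem_powers f⟩ : Submonoid.powers f)).unit

variable {M : Type*} [AddCommGroup M] [Module R M]

/-- Multiplication by `f^k` (`k ∈ ℤ`) on the localization `M[1/f]`, as an `R`-linear map. -/
def fzp (k : ℤ) :
    LocalizedModule (Submonoid.powers f) M →ₗ[R] LocalizedModule (Submonoid.powers f) M :=
  (LinearMap.lsmul (Localization (Submonoid.powers f))
      (LocalizedModule (Submonoid.powers f) M) ((fUnit f ^ k : _ˣ) : _)).restrictScalars R

variable {M' : Type*} [AddCommGroup M'] [Module R M']

/-- The localization `M[1/f] → M'[1/f]` of a linear map `M → M'`. -/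
def locMap (g : M →ₗ[R] M') :
    LocalizedModule (Submonoid.powers f) M →ₗ[R] LocalizedModule (Submonoid.powers f) M' :=
  IsLocalizedModule.map (Submonoid.powers f)
    (LocalizedModule.mkLinearMap (Submonoid.powers f) M)
    (LocalizedModule.mkLinearMap (Submonoid.powers f) M') g

/-- Transport of terms of a `ℤ`-indexed family of modules along an equality of indices. -/
def lcast {N : ℤ → Type*} [∀ i, AddCommGroup (N i)] [∀ i, Module R (N i)]
    {i j : ℤ} (h : i = j) : N i ≃ₗ[R] N j := by
  subst h
  exact LinearEquiv.refl R (N i)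

variable (Mc : ℤ → Type*) [∀ i, AddCommGroup (Mc i)] [∀ i, Module R (Mc i)]
  (d : ∀ i, Mc i →ₗ[R] Mc (i + 1))

/-- The `i`-cocycles of the cochain complex `(Mc, d)`. -/
def cocyc (i : ℤ) : Submodule R (Mc i) := LinearMap.ker (d i)

/-- The `i`-coboundaries of the cochain complex `(Mc, d)`. -/
def cobdy (i : ℤ) : Submodule R (Mc i) :=
  LinearMap.range ((lcast (R := R) (N := Mc) (show i - 1 + 1 = i by omega)).toLinearMap ∘ₗ
    d (i - 1))

/-- The `i`-th cohomology `H^i(Mc) = Z^i/B^i` of the cochain complex `(Mc, d)`. -/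
abbrev cohty (i : ℤ) :=
  cocyc Mc d i ⧸ Submodule.comap (cocyc Mc d i).subtype (cobdy Mc d i)

/-- The degree-`i` piece of the décalage `η_{δ,f}(Mc)`, as a submodule of `Mc^i[1/f]`:
`(η_{δ,f} Mc)^i = { x ∈ f^{δ(i)}·Mc^i : dx ∈ f^{δ(i+1)}·Mc^{i+1} }`. -/
def etaSub (δ : ℤ → ℤ) (i : ℤ) :
    Submodule R (LocalizedModule (Submonoid.powers f) (Mc i)) :=
  Submodule.map (fzp f (δ i))
      (LinearMap.range (LocalizedModule.mkLinearMap (Submonoid.powers f) (Mc i))) ⊓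
    Submodule.comap (locMap f (d i))
      (Submodule.map (fzp f (δ (i + 1)))
        (LinearMap.range (LocalizedModule.mkLinearMap (Submonoid.powers f) (Mc (i + 1)))))

/-- The `i`-cocycles of the décalage complex `η_{δ,f}(Mc)`. -/
def etaCocyc (δ : ℤ → ℤ) (i : ℤ) :
    Submodule R (LocalizedModule (Submonoid.powers f) (Mc i)) :=
  etaSub f Mc d δ i ⊓ LinearMap.ker (locMap f (d i))

/-- The `i`-coboundaries of the décalage complex `η_{δ,f}(Mc)`. -/
def etaCobdy (δ : ℤ → ℤ) (i : ℤ) :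
    Submodule R (LocalizedModule (Submonoid.powers f) (Mc i)) :=
  Submodule.map
    ((lcast (R := R) (N := fun j => LocalizedModule (Submonoid.powers f) (Mc j))
        (show i - 1 + 1 = i by omega)).toLinearMap ∘ₗ locMap f (d (i - 1)))
    (etaSub f Mc d δ (i - 1))

/-- The `i`-th cohomology of the décalage complex `η_{δ,f}(Mc)`. -/
abbrev etaCohty (δ : ℤ → ℤ) (i : ℤ) :=
  etaCocyc f Mc d δ i ⧸
    Submodule.comap (etaCocyc f Mc d δ i).subtype (etaCobdy f Mc d δ i)

/-- The map `M → M[1/f]` sending `x` to `f^k x`, for `k ∈ ℤ`. -/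
def zpowMk (k : ℤ) : M →ₗ[R] LocalizedModule (Submonoid.powers f) M :=
  fzp f k ∘ₗ LocalizedModule.mkLinearMap (Submonoid.powers f) M

theorem zpowMk_apply (k : ℤ) (x : M) :
    zpowMk f k x = fzp f k (LocalizedModule.mkLinearMap (Submonoid.powers f) M x) := rfl

theorem fzp_apply (k : ℤ) (x : LocalizedModule (Submonoid.powers f) M) :
    fzp f k x = ((fUnit f ^ k : (Localization (Submonoid.powers f))ˣ) :
      Localization (Submonoid.powers f)) • x := rfl

theorem coe_fUnit :
    (fUnit f : Localization (Submonoid.powers f)) = algebraMap R _ f := rfl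

theorem fzp_injective (k : ℤ) :
    Function.Injective (fzp f k : LocalizedModule (Submonoid.powers f) M →ₗ[R] _) := by
  intro x y h
  rw [fzp_apply, fzp_apply] at h
  exact (fUnit f ^ k).isUnit.smul_left_cancel.mp h

theorem zpowMk_add_natCast (k : ℤ) (n : ℕ) (x : M) :
    zpowMk f (k + n) x = zpowMk f k (f ^ n • x) := by
  rw [zpowMk_apply, zpowMk_apply, map_smul, fzp_apply, fzp_apply, zpow_add, zpow_natCast,
    Units.val_mul, mul_smul, Units.val_pow_eq_pow_val, coe_fUnit, ← map_pow, algebraMap_smul]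

theorem eq_zero_of_pow_smul_eq_zero (htf : ∀ x : M, f • x = 0 → x = 0) (n : ℕ) {x : M}
    (hx : f ^ n • x = 0) : x = 0 := by
  induction n with
  | zero => simpa using hx
  | succ n ih => exact ih (htf _ (by rwa [smul_smul, ← pow_succ']))

theorem mkLinearMap_injective (htf : ∀ x : M, f • x = 0 → x = 0) :
    Function.Injective (LocalizedModule.mkLinearMap (Submonoid.powers f) M) := by
  rw [injective_iff_map_eq_zero]
  intro x hx
  obtain ⟨⟨_, n, rfl⟩, hc⟩ :=
    (IsLocalizedModule.eq_zero_iff (Submonoid.powers f)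
      (LocalizedModule.mkLinearMap (Submonoid.powers f) M)).mp hx
  exact eq_zero_of_pow_smul_eq_zero f htf n hc

theorem zpowMk_injective (htf : ∀ x : M, f • x = 0 → x = 0) (k : ℤ) :
    Function.Injective (zpowMk f k : M →ₗ[R] _) :=
  (fzp_injective f k).comp (mkLinearMap_injective f htf)

theorem locMap_zpowMk (g : M →ₗ[R] M') (k : ℤ) (x : M) :
    locMap f g (zpowMk f k x) = zpowMk f k (g x) := by
  have key : locMap f g (LocalizedModule.mkLinearMap (Submonoid.powers f) M x) =
      LocalizedModule.mkLinearMap (Submonoid.powers f) M' (g x) :=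
    IsLocalizedModule.map_apply _ _ _ _ _
  rw [zpowMk_apply, zpowMk_apply, fzp_apply, fzp_apply, ← key]
  exact ((locMap f g).extendScalarsOfIsLocalization (Submonoid.powers f)
    (Localization (Submonoid.powers f))).map_smul _ _

theorem lcast_zpowMk {i j : ℤ} (h : i = j) (k : ℤ) (x : Mc i) :
    lcast (R := R) (N := fun j => LocalizedModule (Submonoid.powers f) (Mc j)) h
      (zpowMk f k x) = zpowMk f k (lcast (R := R) (N := Mc) h x) := by
  subst h
  rfl

theorem mem_etaSub {δ : ℤ → ℤ} {i : ℤ} {v : LocalizedModule (Submonoid.powers f) (Mc i)} :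
    v ∈ etaSub f Mc d δ i ↔ (∃ x, zpowMk f (δ i) x = v) ∧
      ∃ y, zpowMk f (δ (i + 1)) y = locMap f (d i) v := by
  simp [etaSub, zpowMk_apply]

theorem mem_etaCocyc {δ : ℤ → ℤ} {i : ℤ} (htf : ∀ (i : ℤ) (x : Mc i), f • x = 0 → x = 0)
    {v : LocalizedModule (Submonoid.powers f) (Mc i)} :
    v ∈ etaCocyc f Mc d δ i ↔ ∃ x ∈ cocyc Mc d i, zpowMk f (δ i) x = v := by
  rw [etaCocyc, Submodule.mem_inf, mem_etaSub, LinearMap.mem_ker]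
  constructor
  · rintro ⟨⟨⟨x, rfl⟩, -⟩, h⟩
    rw [locMap_zpowMk] at h
    exact ⟨x, zpowMk_injective f (htf _) _ (h.trans (map_zero _).symm), rfl⟩
  · rintro ⟨x, hx, rfl⟩
    have hx : d i x = 0 := hx
    rw [locMap_zpowMk, hx, map_zero]
    exact ⟨⟨⟨x, rfl⟩, 0, map_zero _⟩, rfl⟩

theorem mem_cobdy {i : ℤ} {x : Mc i} :
    x ∈ cobdy Mc d i ↔
      ∃ m, lcast (R := R) (N := Mc) (show i - 1 + 1 = i by omega) (d (i - 1) m) = x :=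
  Iff.rfl

theorem zpowMk_mem_etaCobdy {δ : ℤ → ℤ} (hδ : Monotone δ) {i : ℤ}
    (htf : ∀ (i : ℤ) (x : Mc i), f • x = 0 → x = 0) {x : Mc i} :
    zpowMk f (δ i) x ∈ etaCobdy f Mc d δ i ↔
      f ^ (δ i - δ (i - 1)).toNat • x ∈ cobdy Mc d i := by
  have hk : δ i = δ (i - 1) + ((δ i - δ (i - 1)).toNat : ℤ) := by
    rw [Int.toNat_of_nonneg (sub_nonneg.mpr (hδ (by omega)))]
    ring
  have hx : zpowMk f (δ i) x =
      zpowMk f (δ (i - 1)) (f ^ (δ i - δ (i - 1)).toNat • x) := by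
    rw [← zpowMk_add_natCast, ← hk]
  rw [hx, mem_cobdy, etaCobdy, Submodule.mem_map]
  constructor
  · rintro ⟨u, hu, h⟩
    obtain ⟨⟨m, rfl⟩, -⟩ := (mem_etaSub f Mc d).mp hu
    rw [LinearMap.comp_apply, locMap_zpowMk, LinearEquiv.coe_coe, lcast_zpowMk] at h
    exact ⟨m, zpowMk_injective f (htf _) _ h⟩
  · rintro ⟨m, hm⟩
    have hi : i - 1 + 1 = i := by omega
    refine ⟨zpowMk f (δ (i - 1)) m, (mem_etaSub f Mc d).mpr
      ⟨⟨m, rfl⟩, (lcast (R := R) (N := Mc) hi).symm x, ?_⟩, ?_⟩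
    · apply (lcast (R := R) (N := fun j => LocalizedModule (Submonoid.powers f) (Mc j))
        hi).injective
      rw [locMap_zpowMk, lcast_zpowMk, lcast_zpowMk, LinearEquiv.apply_symm_apply, hm, hi, hx]
    · rw [LinearMap.comp_apply, locMap_zpowMk, LinearEquiv.coe_coe, lcast_zpowMk, hm]

/-- Multiplication by `f^{δ(i)}` from the cocycles of `Mc` to those of `η_{δ,f}(Mc)`. -/
def cocycToEta (δ : ℤ → ℤ) (i : ℤ) (htf : ∀ (i : ℤ) (x : Mc i), f • x = 0 → x = 0) :
    cocyc Mc d i →ₗ[R] etaCocyc f Mc d δ i :=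
  (zpowMk f (δ i)).restrict fun x hx => (mem_etaCocyc f Mc d htf).mpr ⟨x, hx, rfl⟩

/-- Multiplication by `f^{δ(i)}` from the cohomology of `Mc` to that of `η_{δ,f}(Mc)`. -/
def cohtyToEta {δ : ℤ → ℤ} (hδ : Monotone δ) (i : ℤ)
    (htf : ∀ (i : ℤ) (x : Mc i), f • x = 0 → x = 0) :
    cohty Mc d i →ₗ[R] etaCohty f Mc d δ i :=
  Submodule.mapQ _ _ (cocycToEta f Mc d δ i htf) fun _ hx =>
    (zpowMk_mem_etaCobdy f Mc d hδ htf).mpr (Submodule.smul_mem _ _ hx)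

theorem cohtyToEta_surjective {δ : ℤ → ℤ} (hδ : Monotone δ) (i : ℤ)
    (htf : ∀ (i : ℤ) (x : Mc i), f • x = 0 → x = 0) :
    Function.Surjective (cohtyToEta f Mc d hδ i htf) := by
  intro y
  obtain ⟨⟨v, hv⟩, rfl⟩ := Submodule.Quotient.mk_surjective _ y
  obtain ⟨x, hx, rfl⟩ := (mem_etaCocyc f Mc d htf).mp hv
  exact ⟨Submodule.Quotient.mk ⟨x, hx⟩, rfl⟩

theorem ker_cohtyToEta {δ : ℤ → ℤ} (hδ : Monotone δ) (i : ℤ)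
    (htf : ∀ (i : ℤ) (x : Mc i), f • x = 0 → x = 0) :
    LinearMap.ker (cohtyToEta f Mc d hδ i htf) =
      Submodule.torsionBy R (cohty Mc d i) (f ^ (δ i - δ (i - 1)).toNat) := by
  ext c
  obtain ⟨x, rfl⟩ := Submodule.Quotient.mk_surjective _ c
  rw [LinearMap.mem_ker, Submodule.mem_torsionBy_iff, ← Submodule.Quotient.mk_smul,
    Submodule.Quotient.mk_eq_zero]
  exact (Submodule.Quotient.mk_eq_zero _).trans (zpowMk_mem_etaCobdy f Mc d hδ htf)

/-- **Bockstein-type description of the cohomology of the décalage.**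
Let `R` be a commutative ring, `f ∈ R` a non-zero-divisor, `δ : ℤ → ℤ` a non-decreasing
function and `Mc` a cochain complex of `f`-torsion-free `R`-modules.  For every `i ∈ ℤ`,
multiplication by `f^{δ(i)}` induces an isomorphism
`H^i(Mc)/H^i(Mc)[f^{δ(i)-δ(i-1)}] ≅ H^i(η_{δ,f} Mc)` (first conjunct).
In particular, the functor `η_{δ,f}` on `f`-torsion-free cochain complexes preserves
quasi-isomorphisms (second conjunct, with quasi-isomorphisms expressed at the level of
cocycles and coboundaries). -/
theorem stmt_0 (hf : f ∈ nonZeroDivisors R) (δ : ℤ → ℤ) (hδ : Monotone δ)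
    (htf : ∀ (i : ℤ) (x : Mc i), f • x = 0 → x = 0)
    (hdd : ∀ i, d (i + 1) ∘ₗ d i = 0) :
    (∀ i : ℤ,
      ∃ φ : (cohty Mc d i ⧸
              Submodule.torsionBy R (cohty Mc d i) (f ^ (δ i - δ (i - 1)).toNat)) ≃ₗ[R]
            etaCohty f Mc d δ i,
        ∀ x : cocyc Mc d i, ∃ y : etaCocyc f Mc d δ i,
          (y : LocalizedModule (Submonoid.powers f) (Mc i))
              = fzp f (δ i) (LocalizedModule.mkLinearMap (Submonoid.powers f) (Mc i) (x : Mc i)) ∧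
          φ (Submodule.Quotient.mk (Submodule.Quotient.mk x)) = Submodule.Quotient.mk y) ∧
    (∀ (Nc : ℤ → Type*) (_ : ∀ i, AddCommGroup (Nc i)) (_ : ∀ i, Module R (Nc i))
        (d' : ∀ i, Nc i →ₗ[R] Nc (i + 1)),
      (∀ (i : ℤ) (x : Nc i), f • x = 0 → x = 0) →
      (∀ i, d' (i + 1) ∘ₗ d' i = 0) →
      ∀ φ : ∀ i, Mc i →ₗ[R] Nc i,
        (∀ i, φ (i + 1) ∘ₗ d i = d' i ∘ₗ φ i) →
        (∀ i : ℤ,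
          (∀ y ∈ cocyc Nc d' i, ∃ x ∈ cocyc Mc d i, φ i x - y ∈ cobdy Nc d' i) ∧
          (∀ x ∈ cocyc Mc d i, φ i x ∈ cobdy Nc d' i → x ∈ cobdy Mc d i)) →
        (∀ i : ℤ,
          (∀ v ∈ etaCocyc f Nc d' δ i, ∃ u ∈ etaCocyc f Mc d δ i,
            locMap f (φ i) u - v ∈ etaCobdy f Nc d' δ i) ∧
          (∀ u ∈ etaCocyc f Mc d δ i,
            locMap f (φ i) u ∈ etaCobdy f Nc d' δ i → u ∈ etaCobdy f Mc d δ i))) := by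
  refine ⟨fun i => ?_, ?_⟩
  · refine ⟨(Submodule.quotEquivOfEq _ _ (ker_cohtyToEta f Mc d hδ i htf).symm).trans
      ((cohtyToEta f Mc d hδ i htf).quotKerEquivOfSurjective
        (cohtyToEta_surjective f Mc d hδ i htf)), fun x => ?_⟩
    exact ⟨cocycToEta f Mc d δ i htf x, rfl, rfl⟩
  · intro Nc _ _ d' htf' _ φ hφ hq i
    refine ⟨fun v hv => ?_, fun u hu h => ?_⟩
    · obtain ⟨y, hy, rfl⟩ := (mem_etaCocyc f Nc d' htf').mp hv
      obtain ⟨x, hx, hxy⟩ := (hq i).1 y hy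
      refine ⟨zpowMk f (δ i) x, (mem_etaCocyc f Mc d htf).mpr ⟨x, hx, rfl⟩, ?_⟩
      rw [locMap_zpowMk, ← map_sub, zpowMk_mem_etaCobdy f Nc d' hδ htf']
      exact Submodule.smul_mem _ _ hxy
    · obtain ⟨x, hx, rfl⟩ := (mem_etaCocyc f Mc d htf).mp hu
      rw [locMap_zpowMk, zpowMk_mem_etaCobdy f Nc d' hδ htf', ← map_smul] at h
      exact (zpowMk_mem_etaCobdy f Mc d hδ htf).mpr
        ((hq i).2 _ (Submodule.smul_mem _ _ hx) h)
end
end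

section
/- If δ₁ is non-decreasing, then η_{δ₁,f}(η_{δ₂,f}(M)) = η_{δ₁+δ₂,f}(M) as subcomplexes of M[1/f]. -/
noncomputable section

variable {R : Type*} [CommRing R] (f : R)

variable {M : Type*} [AddCommGroup M] [Module R M]

variable {M' : Type*} [AddCommGroup M'] [Module R M']

variable (Mc : ℤ → Type*) [∀ i, AddCommGroup (Mc i)] [∀ i, Module R (Mc i)]
  (d : ∀ i, Mc i →ₗ[R] Mc (i + 1))

/-- Given a function `δ : ℤ → ℤ` and a family `Cs` of `R`-submodules of the localizations
`M^i[1/f]`, the degree-`i` piece of `η_{δ,f}` applied to `Cs`: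
`{ x ∈ f^{δ(i)}·Cs^i : dx ∈ f^{δ(i+1)}·Cs^{i+1} }`, inside `M^i[1/f]`. -/
def etaOf (δ : ℤ → ℤ)
    (Cs : ∀ i, Submodule R (LocalizedModule (Submonoid.powers f) (Mc i))) (i : ℤ) :
    Submodule R (LocalizedModule (Submonoid.powers f) (Mc i)) :=
  Submodule.map (fzp f (δ i)) (Cs i) ⊓
    Submodule.comap (locMap f (d i)) (Submodule.map (fzp f (δ (i + 1))) (Cs (i + 1)))

/-- The image of `M^i` in `M^i[1/f]`, i.e. the degree-`i` piece of the complex `M` viewed as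
a subcomplex of `M[1/f]`. -/
def baseSub (i : ℤ) : Submodule R (LocalizedModule (Submonoid.powers f) (Mc i)) :=
  LinearMap.range (LocalizedModule.mkLinearMap (Submonoid.powers f) (Mc i))

theorem fzp_fzp (k l : ℤ) (x : LocalizedModule (Submonoid.powers f) M) :
    fzp f k (fzp f l x) = fzp f (k + l) x := by
  simp only [fzp_apply, zpow_add, Units.val_mul, mul_smul]

theorem fzp_zero (x : LocalizedModule (Submonoid.powers f) M) : fzp f 0 x = x := by
  simp [fzp_apply]

theorem fzp_natCast (n : ℕ) (x : LocalizedModule (Submonoid.powers f) M) :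
    fzp f (n : ℤ) x = f ^ n • x := by
  have h : (fUnit f : Localization (Submonoid.powers f)) = algebraMap R _ f := rfl
  rw [fzp_apply, zpow_natCast, Units.val_pow_eq_pow_val, h, ← map_pow, algebraMap_smul]

theorem mem_map_fzp (k : ℤ) (S : Submodule R (LocalizedModule (Submonoid.powers f) M))
    (x : LocalizedModule (Submonoid.powers f) M) :
    x ∈ S.map (fzp f k) ↔ fzp f (-k) x ∈ S := by
  constructor
  · rintro ⟨y, hy, rfl⟩
    simpa [fzp_fzp, fzp_zero] using hy
  · intro h
    exact ⟨_, h, by simp [fzp_fzp, fzp_zero]⟩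

/-- A submodule is stable under multiplication by non-negative powers of `f`. -/
theorem fzp_mem_of_le {k l : ℤ} (hkl : k ≤ l)
    {S : Submodule R (LocalizedModule (Submonoid.powers f) M)}
    {x : LocalizedModule (Submonoid.powers f) M} (h : fzp f k x ∈ S) : fzp f l x ∈ S := by
  obtain ⟨n, rfl⟩ := Int.le.dest hkl
  rw [add_comm, ← fzp_fzp, fzp_natCast]
  exact S.smul_mem _ h

theorem locMap_fzp (g : M →ₗ[R] M') (k : ℤ) (x : LocalizedModule (Submonoid.powers f) M) :
    locMap f g (fzp f k x) = fzp f k (locMap f g x) := by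
  have := IsLocalization.linearMap_compatibleSMul (Submonoid.powers f)
    (Localization (Submonoid.powers f)) (LocalizedModule (Submonoid.powers f) M)
    (LocalizedModule (Submonoid.powers f) M')
  exact (locMap f g).map_smul_of_tower ((fUnit f ^ k : (Localization (Submonoid.powers f))ˣ) :
    Localization (Submonoid.powers f)) x

theorem locMap_locMap_eq_zero {M'' : Type*} [AddCommGroup M''] [Module R M'']
    {g : M →ₗ[R] M'} {h : M' →ₗ[R] M''} (hgh : h ∘ₗ g = 0)
    (x : LocalizedModule (Submonoid.powers f) M) : locMap f h (locMap f g x) = 0 := by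
  have := IsLocalizedModule.map_comp' (Submonoid.powers f)
    (LocalizedModule.mkLinearMap (Submonoid.powers f) M)
    (LocalizedModule.mkLinearMap (Submonoid.powers f) M')
    (LocalizedModule.mkLinearMap (Submonoid.powers f) M'') g h
  rw [hgh, map_zero] at this
  exact (LinearMap.congr_fun this x).symm

theorem mem_etaOf (δ : ℤ → ℤ)
    (Cs : ∀ i, Submodule R (LocalizedModule (Submonoid.powers f) (Mc i))) (i : ℤ)
    (x : LocalizedModule (Submonoid.powers f) (Mc i)) :
    x ∈ etaOf f Mc d δ Cs i ↔
      fzp f (-δ i) x ∈ Cs i ∧ fzp f (-δ (i + 1)) (locMap f (d i) x) ∈ Cs (i + 1) := by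
  rw [etaOf, Submodule.mem_inf, Submodule.mem_comap, mem_map_fzp, mem_map_fzp]


/-- **Composition of décalage functors.**  Let `R` be a commutative ring, `f ∈ R` a
non-zero-divisor, `δ₁ δ₂ : ℤ → ℤ` with `δ₁` non-decreasing, and `M` a cochain complex of
`f`-torsion-free `R`-modules.  Then `η_{δ₁,f}(η_{δ₂,f}(M)) = η_{δ₁+δ₂,f}(M)` as subcomplexes
of `M[1/f]`. -/
theorem stmt_1 (hf : f ∈ nonZeroDivisors R) (δ₁ δ₂ : ℤ → ℤ) (hδ₁ : Monotone δ₁)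
    (htf : ∀ (i : ℤ) (x : Mc i), f • x = 0 → x = 0)
    (hdd : ∀ i, d (i + 1) ∘ₗ d i = 0) :
    ∀ i : ℤ, etaOf f Mc d δ₁ (etaOf f Mc d δ₂ (baseSub f Mc)) i
      = etaOf f Mc d (δ₁ + δ₂) (baseSub f Mc) i := by
  intro i
  ext x
  simp only [mem_etaOf, fzp_fzp, locMap_fzp, locMap_locMap_eq_zero f (hdd i), map_zero,
    zero_mem, and_true, Pi.add_apply, neg_add_rev]
  refine ⟨fun h => ⟨h.1.1, h.2⟩, fun h => ⟨⟨h.1, fzp_mem_of_le f ?_ h.2⟩, h.2⟩⟩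
  have := hδ₁ (Int.le_add_one le_rfl : i ≤ i + 1)
  lia
end
end
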